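/- arXiv:2003.00815 — 2 statements merged into one kernel-verified Lean document; each statement's English description precedes it below -/
import Mathlib

section
/- Stabilizer of the edges e_r and ē_r: Let r be a non-negative integer and γ ∈ GL₂(A). Then diag(θ^r,1)^{−1}·γ·diag(θ^r,1) ∈ K_∞^×·I_∞ if and only if γ = (a, b; 0, d) with a, d ∈ 𝔽_q^×, b ∈ A and deg b ≤ r; moreover the same equivalence holds with diag(θ^r,1) replaced throughout by diag(θ^r,1)·(0, 1; π_∞, 0). (This computes the stabilizers in Γ := GL₂(A) of the oriented edges e_r and ē_r of the Bruhat–Tits tree of PGL₂(K_∞), the oriented edges of the tree being GL₂(K_∞)/K_∞^×·I_∞.) -/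
open Polynomial Matrix

noncomputable section

namespace SturmFF

variable (Fq : Type) [Field Fq] [Fintype Fq]

/-- The local field `K_∞ = 𝔽_q((π_∞))`. -/
abbrev Kinf := LaurentSeries Fq

/-- The uniformizer `π_∞`. -/
def piInf : Kinf Fq := HahnSeries.single 1 1

/-- The element `θ = π_∞⁻¹` of `K_∞`. -/
def thetaK : Kinf Fq := HahnSeries.single (-1) 1

/-- The embedding `A = 𝔽_q[θ] → K_∞` sending `θ` to `π_∞⁻¹`. -/
def polyToK : Polynomial Fq →+* Kinf Fq := (Polynomial.aeval (thetaK Fq)).toRingHom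

/-- Membership in the valuation ring `O_∞ = 𝔽_q[[π_∞]]`. -/
def memO (x : Kinf Fq) : Prop := ∀ n : ℤ, n < 0 → x.coeff n = 0

/-- A matrix has all entries in `O_∞`. -/
def MatO (κ : Matrix (Fin 2) (Fin 2) (Kinf Fq)) : Prop := ∀ i j, memO Fq (κ i j)

/-- Membership in `GL₂(O_∞)`: entries in `O_∞` and determinant a unit of `O_∞`. -/
def InGLO (κ : Matrix (Fin 2) (Fin 2) (Kinf Fq)) : Prop :=
  MatO Fq κ ∧ κ.det.coeff 0 ≠ 0

/-- Membership in the Iwahori subgroup `I_∞ ⊆ GL₂(O_∞)`. -/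
def InIw (κ : Matrix (Fin 2) (Fin 2) (Kinf Fq)) : Prop :=
  InGLO Fq κ ∧ ∀ n : ℤ, n < 1 → (κ 1 0).coeff n = 0

/-- The matrix `diag(θ^r, 1)`. -/
def Dmat (r : ℕ) : Matrix (Fin 2) (Fin 2) (Kinf Fq) := !![thetaK Fq ^ r, 0; 0, 1]

/-- The matrix `(0, 1; π_∞, 0)`. -/
def Jmat : Matrix (Fin 2) (Fin 2) (Kinf Fq) := !![0, 1; piInf Fq, 0]

/-- The Atkin–Lehner/Fricke matrix `w_𝔫 = (0, -1; 𝔫, 0)`. -/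
def wmat (𝔫 : Polynomial Fq) : Matrix (Fin 2) (Fin 2) (Kinf Fq) :=
  !![0, -1; polyToK Fq 𝔫, 0]

/-- Membership in the Hecke congruence subgroup `Γ₀(𝔫) ⊆ GL₂(A)`. -/
def InGamma0 (𝔫 : Polynomial Fq) (γ : Matrix (Fin 2) (Fin 2) (Polynomial Fq)) : Prop :=
  IsUnit γ.det ∧ 𝔫 ∣ γ 1 0

/-- A `Γ₀(𝔫)`-invariant harmonic cochain, viewed as a function on `GL₂(K_∞)`
(encoded as a function on all matrices, with the conditions imposed on invertible ones). -/
def Harmonic (𝔫 : Polynomial Fq) (f : Matrix (Fin 2) (Fin 2) (Kinf Fq) → ℂ) : Prop :=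
  (∀ g : Matrix (Fin 2) (Fin 2) (Kinf Fq), g.det ≠ 0 →
    ∀ γ : Matrix (Fin 2) (Fin 2) (Polynomial Fq), InGamma0 Fq 𝔫 γ →
    ∀ z : Kinf Fq, z ≠ 0 → ∀ κ : Matrix (Fin 2) (Fin 2) (Kinf Fq), InIw Fq κ →
      f (γ.map (polyToK Fq) * g * (z • (1 : Matrix (Fin 2) (Fin 2) (Kinf Fq))) * κ) = f g)
  ∧ (∀ g : Matrix (Fin 2) (Fin 2) (Kinf Fq), g.det ≠ 0 → f (g * Jmat Fq) = - f g)
  ∧ (∀ g : Matrix (Fin 2) (Fin 2) (Kinf Fq), g.det ≠ 0 →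
      (∑ ε : Fq, f (g * !![1, 0; polyToK Fq (Polynomial.C ε), 1])) + f (g * !![0, 1; 1, 0]) = 0)

/-- A harmonic cochain is cuspidal if it is finitely supported modulo
`Γ₀(𝔫)` on the left and `K_∞^× I_∞` on the right. -/
def Cuspidal (𝔫 : Polynomial Fq) (f : Matrix (Fin 2) (Fin 2) (Kinf Fq) → ℂ) : Prop :=
  ∃ S : Finset (Matrix (Fin 2) (Fin 2) (Kinf Fq)),
    ∀ g : Matrix (Fin 2) (Fin 2) (Kinf Fq), g.det ≠ 0 → f g ≠ 0 →
      ∃ s ∈ S, ∃ γ : Matrix (Fin 2) (Fin 2) (Polynomial Fq), InGamma0 Fq 𝔫 γ ∧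
        ∃ z : Kinf Fq, z ≠ 0 ∧ ∃ κ : Matrix (Fin 2) (Fin 2) (Kinf Fq), InIw Fq κ ∧
          g = γ.map (polyToK Fq) * s * (z • (1 : Matrix (Fin 2) (Fin 2) (Kinf Fq))) * κ

/-- The additive character `ψ` of `K_∞`. -/
def psi (x : Kinf Fq) : ℂ :=
  letI := ZMod.algebra Fq (ringChar Fq)
  Complex.exp (2 * Real.pi * Complex.I *
    ((Algebra.trace (ZMod (ringChar Fq)) Fq (x.coeff 1)).val : ℂ) / (ringChar Fq : ℂ))

/-- The constant Fourier coefficient `c₀(f)`. -/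
def c0 (f : Matrix (Fin 2) (Fin 2) (Kinf Fq) → ℂ) : ℂ :=
  (Fintype.card Fq : ℂ)⁻¹ *
    ∑ c : Fq, f !![piInf Fq ^ 2, polyToK Fq (Polynomial.C c) * piInf Fq; 0, 1]

/-- The element `u = Σ_{i=1}^{d+1} c_i π_∞^i` of `K_∞` attached to a tuple of coefficients. -/
def uOf (d : ℕ) (c : Fin (d + 1) → Fq) : Kinf Fq :=
  ∑ i : Fin (d + 1), HahnSeries.single ((i : ℤ) + 1) (c i)

/-- The Fourier coefficient `c_𝔪(f)` for a monic polynomial `𝔪`. -/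
def cm (𝔪 : Polynomial Fq) (f : Matrix (Fin 2) (Fin 2) (Kinf Fq) → ℂ) : ℂ :=
  (Fintype.card Fq : ℂ)⁻¹ *
    ∑ c : Fin (𝔪.natDegree + 1) → Fq,
      f !![piInf Fq ^ (𝔪.natDegree + 2), uOf Fq 𝔪.natDegree c; 0, 1] *
        psi Fq (-(polyToK Fq 𝔪 * uOf Fq 𝔪.natDegree c))

/-- `δ_𝔫(c,d)`: the least `m` such that some `x, y` of degree at most `m`
satisfy `gcd(cx + dy, 𝔫) = 1`. -/
def deltaN (𝔫 c d : Polynomial Fq) : ℕ :=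
  sInf { m : ℕ | ∃ x y : Polynomial Fq, x.degree ≤ (m : WithBot ℕ) ∧
    y.degree ≤ (m : WithBot ℕ) ∧ IsCoprime (c * x + d * y) 𝔫 }

open Classical in
/-- `ε_𝔫(c,d) ∈ {0,1}`. -/
def epsN (𝔫 c d : Polynomial Fq) : ℕ :=
  if ∃ x₀ y₀ : Polynomial Fq, y₀.degree < x₀.degree ∧
      x₀.degree = (deltaN Fq 𝔫 c d : WithBot ℕ) ∧ IsCoprime (c * x₀ + d * y₀) 𝔫
  then 0 else 1

/-- The set `S(c,d;m)`. -/
def Sset (c d : Polynomial Fq) (m : ℕ) : Set (Polynomial Fq) :=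
  { z | ∃ x y : Polynomial Fq, x.degree ≤ (m : WithBot ℕ) ∧ y.degree ≤ (m : WithBot ℕ) ∧
      z = x * c + y * d }

/-- `t(c,d;m)`: the largest cardinality of a pairwise-coprime subset of `S(c,d;m)`. -/
def tcd (c d : Polynomial Fq) (m : ℕ) : ℕ :=
  sSup { n : ℕ | ∃ S' : Finset (Polynomial Fq), ↑S' ⊆ Sset Fq c d m ∧
    (∀ a ∈ S', ∀ b ∈ S', a ≠ b → IsCoprime a b) ∧ S'.card = n }

/-- `t(m,n) ∈ ℕ∞`. -/
def tmn (m n : ℕ) : ℕ∞ :=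
  sInf { k : ℕ∞ | ∃ c d : Polynomial Fq, IsCoprime c d ∧
    ((m : WithBot ℕ) + 1) < max c.degree d.degree ∧ max c.degree d.degree < (n : WithBot ℕ) ∧
    k = (tcd Fq c d m : ℕ∞) }

/-- `t(𝔫)`: the number of distinct monic prime factors of `𝔫`. -/
def tPrimes (𝔫 : Polynomial Fq) : ℕ :=
  Set.ncard { p : Polynomial Fq | p.Monic ∧ Irreducible p ∧ p ∣ 𝔫 }

/-- `τ(𝔫)`. -/
def tauN (𝔫 : Polynomial Fq) : ℕ :=
  sInf { m : ℕ | (tPrimes Fq 𝔫 : ℕ∞) < tmn Fq m 𝔫.natDegree }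

/-- The coefficients of a polynomial in `θ = π_∞⁻¹`, viewed as a Laurent series in `π_∞`. -/
theorem coeff_polyToK (p : Polynomial Fq) (n : ℤ) :
    (polyToK Fq p).coeff n = if n ≤ 0 then p.coeff (-n).toNat else 0 := by
  induction p using Polynomial.induction_on' with
  | add p q hp hq =>
    rw [map_add, HahnSeries.coeff_add, hp, hq, Polynomial.coeff_add]
    split_ifs <;> simp
  | monomial k a =>
    have h : polyToK Fq (Polynomial.monomial k a) = HahnSeries.single (-(k : ℤ)) a := by
      change Polynomial.aeval (thetaK Fq) (Polynomial.monomial k a) = _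
      rw [Polynomial.aeval_monomial, thetaK, HahnSeries.single_pow,
        LaurentSeries.algebraMap_apply, HahnSeries.C_apply, HahnSeries.single_mul_single]
      simp
    rw [h, HahnSeries.coeff_single, Polynomial.coeff_monomial]
    split_ifs <;> first | rfl | omega

theorem thetaK_ne_zero : thetaK Fq ≠ 0 := by simp [thetaK]

theorem piInf_mul_thetaK : piInf Fq * thetaK Fq = 1 := by
  simp [piInf, thetaK, HahnSeries.single_mul_single]

theorem thetaK_pow (r : ℕ) : thetaK Fq ^ r = HahnSeries.single (-(r : ℤ)) 1 := by
  simp [thetaK, HahnSeries.single_pow]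

theorem thetaK_pow_inv (r : ℕ) : (thetaK Fq ^ r)⁻¹ = HahnSeries.single (r : ℤ) 1 := by
  refine inv_eq_of_mul_eq_one_left ?_
  simp [thetaK_pow, HahnSeries.single_mul_single]

theorem forall_coeff_eq_zero_iff (x : Kinf Fq) (k : ℤ) :
    (∀ n : ℤ, n < k → x.coeff n = 0) ↔ (k : WithTop ℤ) ≤ x.orderTop := by
  rw [HahnSeries.le_orderTop_iff_forall]
  simp only [WithTop.coe_lt_coe]

theorem orderTop_eq_zero_of_memO {x : Kinf Fq} (hx : memO Fq x) (h : x.coeff 0 ≠ 0) :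
    x.orderTop = 0 :=
  le_antisymm (HahnSeries.orderTop_le_of_coeff_ne_zero h)
    ((forall_coeff_eq_zero_iff Fq x 0).1 hx)

theorem memO_det {κ : Matrix (Fin 2) (Fin 2) (Kinf Fq)} (h : MatO Fq κ) : memO Fq κ.det := by
  have h' : ∀ i j, (0 : WithTop ℤ) ≤ (κ i j).orderTop := fun i j =>
    (forall_coeff_eq_zero_iff Fq _ 0).1 (h i j)
  refine (forall_coeff_eq_zero_iff Fq _ 0).2 ?_
  rw [Matrix.det_fin_two]
  refine le_trans (le_min ?_ ?_) HahnSeries.min_orderTop_le_orderTop_sub <;>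
    rw [HahnSeries.orderTop_mul] <;> exact add_nonneg (h' _ _) (h' _ _)

/-- If a scalar multiple of an element of `GL₂(O_∞)` has determinant of order `0`, then so does
the scalar. -/
theorem orderTop_eq_zero_of_det_smul {z : Kinf Fq} {κ : Matrix (Fin 2) (Fin 2) (Kinf Fq)}
    (hκ : InGLO Fq κ) (h : (z • κ).det.orderTop = 0) : z.orderTop = 0 := by
  have hd := orderTop_eq_zero_of_memO Fq (memO_det Fq hκ.1) hκ.2
  rw [Matrix.det_smul, Fintype.card_fin, pow_two, HahnSeries.orderTop_mul,
    HahnSeries.orderTop_mul, hd, add_zero] at h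
  cases hz : z.orderTop with
  | top => simp [hz] at h
  | coe n =>
    rw [hz] at h
    norm_cast at h ⊢
    omega

theorem Jmat_inv : (Jmat Fq)⁻¹ = !![0, thetaK Fq; 1, 0] := by
  refine Matrix.inv_eq_right_inv ?_
  simp [Jmat, piInf_mul_thetaK, Matrix.one_fin_two]

theorem Jmat_inv_mul_mul (M : Matrix (Fin 2) (Fin 2) (Kinf Fq)) :
    (Jmat Fq)⁻¹ * M * Jmat Fq =
      !![M 1 1, thetaK Fq * M 1 0; piInf Fq * M 0 1, M 0 0] := by
  have h := piInf_mul_thetaK Fq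
  rw [Jmat_inv, Matrix.eta_fin_two M, Jmat]
  simp only [Matrix.mul_fin_two]
  refine Matrix.ext fun i j => ?_
  fin_cases i <;> fin_cases j <;> simp
  · linear_combination M 1 1 * h
  · ring

theorem Jmat_conj_conj (M : Matrix (Fin 2) (Fin 2) (Kinf Fq)) :
    (Jmat Fq)⁻¹ * ((Jmat Fq)⁻¹ * M * Jmat Fq) * Jmat Fq = M := by
  have h := piInf_mul_thetaK Fq
  rw [Jmat_inv_mul_mul Fq M, Jmat_inv_mul_mul]
  refine Matrix.ext fun i j => ?_
  fin_cases i <;> fin_cases j <;> simp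
  · linear_combination M 0 1 * h
  · linear_combination M 1 0 * h

/-- The matrix `(0, 1; π_∞, 0)` normalizes the Iwahori subgroup. -/
theorem InIw.conj_Jmat {κ : Matrix (Fin 2) (Fin 2) (Kinf Fq)} (hκ : InIw Fq κ) :
    InIw Fq ((Jmat Fq)⁻¹ * κ * Jmat Fq) := by
  obtain ⟨⟨hO, hdet⟩, hc⟩ := hκ
  rw [Jmat_inv_mul_mul]
  have hpi : ∀ n : ℤ, n < 1 → (piInf Fq * κ 0 1).coeff n = 0 := fun n hn => by
    rw [piInf, HahnSeries.coeff_single_mul, one_mul]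
    exact hO 0 1 _ (by omega)
  refine ⟨⟨fun i j => ?_, ?_⟩, hpi⟩
  · fin_cases i <;> fin_cases j
    · exact hO 1 1
    · intro n hn
      change (thetaK Fq * κ 1 0).coeff n = 0
      rw [thetaK, HahnSeries.coeff_single_mul, one_mul]
      exact hc _ (by omega)
    · exact fun n hn => hpi n (by omega)
    · exact hO 0 0
  · rw [Matrix.det_fin_two] at hdet
    rw [Matrix.det_fin_two_of]
    convert hdet using 2
    linear_combination (-(κ 0 1 * κ 1 0)) * piInf_mul_thetaK Fq

theorem exists_smul_conj_Jmat {M : Matrix (Fin 2) (Fin 2) (Kinf Fq)}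
    (h : ∃ z : Kinf Fq, z ≠ 0 ∧ ∃ κ : Matrix (Fin 2) (Fin 2) (Kinf Fq), InIw Fq κ ∧ M = z • κ) :
    ∃ z : Kinf Fq, z ≠ 0 ∧ ∃ κ : Matrix (Fin 2) (Fin 2) (Kinf Fq), InIw Fq κ ∧
      (Jmat Fq)⁻¹ * M * Jmat Fq = z • κ := by
  obtain ⟨z, hz, κ, hκ, rfl⟩ := h
  exact ⟨z, hz, _, hκ.conj_Jmat, by rw [Matrix.mul_smul, Matrix.smul_mul]⟩

theorem Dmat_inv_mul_mul (r : ℕ) (M : Matrix (Fin 2) (Fin 2) (Kinf Fq)) :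
    (Dmat Fq r)⁻¹ * M * Dmat Fq r =
      !![M 0 0, (thetaK Fq ^ r)⁻¹ * M 0 1; thetaK Fq ^ r * M 1 0, M 1 1] := by
  have h : thetaK Fq ^ r ≠ 0 := pow_ne_zero _ (thetaK_ne_zero Fq)
  have hinv : (Dmat Fq r)⁻¹ = !![(thetaK Fq ^ r)⁻¹, 0; 0, 1] := by
    refine Matrix.inv_eq_right_inv ?_
    simp [Dmat, Matrix.one_fin_two, mul_inv_cancel₀ h]
  rw [hinv, Matrix.eta_fin_two M, Dmat]
  simp only [Matrix.mul_fin_two]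
  refine Matrix.ext fun i j => ?_
  fin_cases i <;> fin_cases j <;> simp
  · field_simp
  · ring

theorem exists_smul_conj_Dmat_iff (r : ℕ) (γ : Matrix (Fin 2) (Fin 2) (Polynomial Fq))
    (hγ : IsUnit γ.det) :
    (∃ z : Kinf Fq, z ≠ 0 ∧ ∃ κ : Matrix (Fin 2) (Fin 2) (Kinf Fq), InIw Fq κ ∧
        (Dmat Fq r)⁻¹ * γ.map (polyToK Fq) * Dmat Fq r = z • κ)
      ↔ (γ 1 0 = 0 ∧ (∃ a : Fq, a ≠ 0 ∧ γ 0 0 = Polynomial.C a)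
          ∧ (∃ d : Fq, d ≠ 0 ∧ γ 1 1 = Polynomial.C d)
          ∧ (γ 0 1).degree ≤ (r : WithBot ℕ)) := by
  obtain ⟨u, hu, hdet⟩ := Polynomial.isUnit_iff.1 hγ
  have hu0 : u ≠ 0 := hu.ne_zero
  have hθ : thetaK Fq ^ r ≠ 0 := pow_ne_zero _ (thetaK_ne_zero Fq)
  rw [Dmat_inv_mul_mul]
  simp only [Matrix.map_apply]
  set M : Matrix (Fin 2) (Fin 2) (Kinf Fq) :=
    !![polyToK Fq (γ 0 0), (thetaK Fq ^ r)⁻¹ * polyToK Fq (γ 0 1);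
      thetaK Fq ^ r * polyToK Fq (γ 1 0), polyToK Fq (γ 1 1)] with hM
  have hMdet : M.det = polyToK Fq (Polynomial.C u) := by
    rw [hdet, Matrix.det_fin_two γ, hM, Matrix.det_fin_two_of, map_sub, map_mul, map_mul]
    field_simp
  have hcoeff : M.det.coeff 0 ≠ 0 := by
    rw [hMdet, coeff_polyToK]
    simpa using hu0
  constructor
  · rintro ⟨z, -, κ, ⟨hκ, hκc⟩, h⟩
    have hMO : M.det.orderTop = 0 := by
      refine orderTop_eq_zero_of_memO Fq (fun n hn => ?_) hcoeff
      rw [hMdet, coeff_polyToK, if_pos hn.le, Polynomial.coeff_C_of_ne_zero (by omega)]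
    have hz0 := orderTop_eq_zero_of_det_smul Fq hκ (h ▸ hMO)
    have hord : ∀ i j, (M i j).orderTop = (κ i j).orderTop := fun i j => by
      rw [h, Matrix.smul_apply, smul_eq_mul, HahnSeries.orderTop_mul, hz0, zero_add]
    have hc : γ 1 0 = 0 := by
      have h1 := (forall_coeff_eq_zero_iff Fq (M 1 0) 1).2
        (hord 1 0 ▸ (forall_coeff_eq_zero_iff Fq _ 1).1 hκc)
      ext n
      have h2 := h1 (-(n : ℤ) - r) (by omega)
      change (thetaK Fq ^ r * polyToK Fq (γ 1 0)).coeff _ = 0 at h2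
      rw [thetaK_pow, HahnSeries.coeff_single_mul, one_mul, coeff_polyToK,
        if_pos (by omega)] at h2
      rw [Polynomial.coeff_zero, ← h2]
      congr 1
      omega
    have had : γ 0 0 * γ 1 1 = Polynomial.C u := by
      rw [hdet, Matrix.det_fin_two γ, hc, mul_zero, sub_zero]
    have hunit : IsUnit (γ 0 0 * γ 1 1) := had ▸ Polynomial.isUnit_C.2 hu
    obtain ⟨a, ha, ha'⟩ := Polynomial.isUnit_iff.1 (isUnit_of_mul_isUnit_left hunit)
    obtain ⟨d, hd, hd'⟩ := Polynomial.isUnit_iff.1 (isUnit_of_mul_isUnit_right hunit)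
    refine ⟨hc, ⟨a, ha.ne_zero, ha'.symm⟩, ⟨d, hd.ne_zero, hd'.symm⟩, ?_⟩
    have h1 := (forall_coeff_eq_zero_iff Fq (M 0 1) 0).2
      (hord 0 1 ▸ (forall_coeff_eq_zero_iff Fq _ 0).1 (hκ.1 0 1))
    rw [Polynomial.degree_le_iff_coeff_zero]
    intro n hn
    have hn' : r < n := by exact_mod_cast hn
    have h2 := h1 ((r : ℤ) - n) (by omega)
    change ((thetaK Fq ^ r)⁻¹ * polyToK Fq (γ 0 1)).coeff _ = 0 at h2
    rw [thetaK_pow_inv, HahnSeries.coeff_single_mul, one_mul, coeff_polyToK,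
      if_pos (by omega)] at h2
    convert h2 using 2
    omega
  · rintro ⟨hc, ⟨a, ha, ha'⟩, ⟨d, hd, hd'⟩, hb⟩
    have hconst : ∀ c : Fq, memO Fq (polyToK Fq (Polynomial.C c)) := fun c n hn => by
      rw [coeff_polyToK, if_pos hn.le, Polynomial.coeff_C_of_ne_zero (by omega)]
    have hM10 : M 1 0 = 0 := by simp [hM, hc]
    refine ⟨1, one_ne_zero, M, ⟨⟨fun i j => ?_, hcoeff⟩, fun n _ => by rw [hM10]; rfl⟩,
      (one_smul _ _).symm⟩
    fin_cases i <;> fin_cases j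
    · change memO Fq (polyToK Fq (γ 0 0))
      exact ha' ▸ hconst a
    · intro n hn
      change ((thetaK Fq ^ r)⁻¹ * polyToK Fq (γ 0 1)).coeff n = 0
      rw [thetaK_pow_inv, HahnSeries.coeff_single_mul, one_mul, coeff_polyToK,
        if_pos (by omega)]
      refine Polynomial.degree_le_iff_coeff_zero _ _ |>.1 hb _ ?_
      have : r < (-(n - r)).toNat := by omega
      exact_mod_cast this
    · change memO Fq (M 1 0)
      rw [hM10]
      exact fun _ _ => rfl
    · change memO Fq (polyToK Fq (γ 1 1))
      exact hd' ▸ hconst d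

/-- **Stabilizers of the oriented edges `e_r` and `ē_r`** of the Bruhat–Tits tree. -/
theorem stabilizer_edges
    (Fq : Type) [Field Fq] [Fintype Fq]
    (r : ℕ) (γ : Matrix (Fin 2) (Fin 2) (Polynomial Fq)) (hγ : IsUnit γ.det) :
    ((∃ z : Kinf Fq, z ≠ 0 ∧ ∃ κ : Matrix (Fin 2) (Fin 2) (Kinf Fq), InIw Fq κ ∧
        (Dmat Fq r)⁻¹ * γ.map (polyToK Fq) * Dmat Fq r = z • κ)
      ↔ (γ 1 0 = 0 ∧ (∃ a : Fq, a ≠ 0 ∧ γ 0 0 = Polynomial.C a)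
          ∧ (∃ d : Fq, d ≠ 0 ∧ γ 1 1 = Polynomial.C d)
          ∧ (γ 0 1).degree ≤ (r : WithBot ℕ)))
    ∧ ((∃ z : Kinf Fq, z ≠ 0 ∧ ∃ κ : Matrix (Fin 2) (Fin 2) (Kinf Fq), InIw Fq κ ∧
        (Dmat Fq r * Jmat Fq)⁻¹ * γ.map (polyToK Fq) * (Dmat Fq r * Jmat Fq) = z • κ)
      ↔ (γ 1 0 = 0 ∧ (∃ a : Fq, a ≠ 0 ∧ γ 0 0 = Polynomial.C a)
          ∧ (∃ d : Fq, d ≠ 0 ∧ γ 1 1 = Polynomial.C d)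
          ∧ (γ 0 1).degree ≤ (r : WithBot ℕ))) := by
  refine ⟨exists_smul_conj_Dmat_iff Fq r γ hγ, ?_⟩
  rw [← exists_smul_conj_Dmat_iff Fq r γ hγ]
  have hconj : (Dmat Fq r * Jmat Fq)⁻¹ * γ.map (polyToK Fq) * (Dmat Fq r * Jmat Fq) =
      (Jmat Fq)⁻¹ * ((Dmat Fq r)⁻¹ * γ.map (polyToK Fq) * Dmat Fq r) * Jmat Fq := by
    rw [Matrix.mul_inv_rev]
    simp only [Matrix.mul_assoc]
  rw [hconj]
  refine ⟨fun h => ?_, exists_smul_conj_Jmat Fq⟩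
  have h' := exists_smul_conj_Jmat Fq h
  rwa [Jmat_conj_conj] at h'
end SturmFF
end
end

section
/- Standard form of the edge γ·e₀ (part 2): Let 𝔫 ∈ A₊, let γ = (a, b; c, d) ∈ GL₂(A), and let x, y ∈ A with gcd(x, y) = 1 and gcd(𝔫, cx + dy) = 1. Set δ := max(deg x, deg y), and set ε := 0 if deg x > deg y and ε := 1 otherwise. Then there exist γ₀ ∈ Γ₀(𝔫), u ∈ K_∞, z ∈ K_∞^×, and κ ∈ I_∞ such that γ₀·γ = w_𝔫 · (π_∞^{deg 𝔫 + 2δ + ε}, u; 0, 1) · (0, 1; π_∞, 0)^ε · z · κ, where w_𝔫 := (0, −1; 𝔫, 0). -/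
open Polynomial Matrix

noncomputable section

namespace SturmFF

variable (Fq : Type) [Field Fq] [Fintype Fq]

theorem polyToK_coeff (F : Type) [Field F] (p : Polynomial F) (n : ℤ) :
    (polyToK F p).coeff n = ∑ i ∈ p.support, if n = -(i : ℤ) then p.coeff i else 0 := by
  have h : polyToK F p = ∑ i ∈ p.support, HahnSeries.single (-(i : ℤ)) (p.coeff i) := by
    change Polynomial.aeval (thetaK F) p = _
    rw [Polynomial.aeval_def, Polynomial.eval₂_eq_sum, Polynomial.sum_def]
    refine Finset.sum_congr rfl fun i _ => ?_
    rw [thetaK, HahnSeries.single_pow, LaurentSeries.algebraMap_apply, HahnSeries.C_apply,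
      HahnSeries.single_mul_single]
    simp
  rw [h, HahnSeries.coeff_sum]
  exact Finset.sum_congr rfl fun i _ => by rw [HahnSeries.coeff_single]; congr

theorem polyToK_coeff_neg_natDegree (F : Type) [Field F] (p : Polynomial F) :
    (polyToK F p).coeff (-(p.natDegree : ℤ)) = p.leadingCoeff := by
  rw [polyToK_coeff]
  simp only [neg_inj, Nat.cast_inj]
  rw [Finset.sum_ite_eq, Polynomial.leadingCoeff]
  exact ite_eq_left_iff.2 fun h => (Polynomial.notMem_support_iff.1 h).symm

theorem polyToK_coeff_of_lt (F : Type) [Field F] (p : Polynomial F) {n : ℤ}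
    (hn : n < -(p.natDegree : ℤ)) :
    (polyToK F p).coeff n = 0 := by
  rw [polyToK_coeff]
  refine Finset.sum_eq_zero fun i hi => if_neg ?_
  have := Polynomial.le_natDegree_of_mem_supp i hi
  omega

theorem polyToK_ne_zero (F : Type) [Field F] {p : Polynomial F} (hp : p ≠ 0) :
    polyToK F p ≠ 0 := by
  intro h
  have := polyToK_coeff_neg_natDegree F p
  rw [h] at this
  exact hp (Polynomial.leadingCoeff_eq_zero.1 this.symm)

theorem polyToK_order (F : Type) [Field F] {p : Polynomial F} (hp : p ≠ 0) :
    (polyToK F p).order = -(p.natDegree : ℤ) := by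
  apply le_antisymm
  · apply HahnSeries.order_le_of_coeff_ne_zero
    rw [polyToK_coeff_neg_natDegree]
    exact Polynomial.leadingCoeff_ne_zero.2 hp
  · by_contra! h
    refine (HahnSeries.coeff_order_eq_zero.not.2 (polyToK_ne_zero F hp)) ?_
    exact polyToK_coeff_of_lt F p h

theorem order_div {F : Type} [Field F] {f g : LaurentSeries F} (hf : f ≠ 0) (hg : g ≠ 0) :
    (f / g).order = f.order - g.order := by
  have h := HahnSeries.order_mul (div_ne_zero hf hg) hg
  rw [div_mul_cancel₀ _ hg] at h
  omega

theorem piInf_ne_zero (F : Type) [Field F] : piInf F ≠ 0 := HahnSeries.single_ne_zero one_ne_zero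

theorem piInf_pow_order (F : Type) [Field F] (k : ℕ) : (piInf F ^ k).order = k := by
  rw [HahnSeries.order_pow, piInf, HahnSeries.order_single one_ne_zero]
  simp

theorem polyToK_div_coeff_of_lt (F : Type) [Field F] {p q : Polynomial F} (hq : q ≠ 0) {n : ℤ}
    (hn : n < (q.natDegree : ℤ) - p.natDegree) :
    (polyToK F p / polyToK F q).coeff n = 0 := by
  rcases eq_or_ne p 0 with rfl | hp
  · simp
  apply HahnSeries.coeff_eq_zero_of_lt_order
  rw [order_div (polyToK_ne_zero F hp) (polyToK_ne_zero F hq), polyToK_order F hp,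
    polyToK_order F hq]
  omega

theorem memO_of_order_eq_zero (F : Type) [Field F] {f : Kinf F} (h : f.order = 0) :
    memO F f := fun n hn =>
  HahnSeries.coeff_eq_zero_of_lt_order (by rwa [h])

theorem coeff_zero_ne_zero (F : Type) [Field F] {f : Kinf F} (hf : f ≠ 0) (h : f.order = 0) :
    f.coeff 0 ≠ 0 := by
  rw [← h]
  exact HahnSeries.coeff_order_eq_zero.not.2 hf

theorem memO_zero (F : Type) [Field F] : memO F 0 := fun _ _ => rfl

theorem memO_one (F : Type) [Field F] : memO F 1 := memO_of_order_eq_zero F HahnSeries.order_one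

theorem memO_neg (F : Type) [Field F] {f : Kinf F} (h : memO F f) : memO F (-f) := fun n hn => by
  rw [HahnSeries.coeff_neg, h n hn, neg_zero]

theorem fin_two_congr {R : Type*} {a b c d a' b' c' d' : R} (ha : a = a') (hb : b = b')
    (hc : c = c') (hd : d = d') : !![a, b; c, d] = !![a', b'; c', d'] := by
  rw [ha, hb, hc, hd]

/-- The bottom row of `γ`, paired with a vector `(x, y)` whose value is coprime to `𝔫`, lets one
move the top row to `(y, -x)` by an element of `Γ₀(𝔫)` of determinant one. -/
theorem exists_gamma0_top_row (F : Type) [Field F] (𝔫 : Polynomial F)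
    (γ : Matrix (Fin 2) (Fin 2) (Polynomial F)) (hγ : IsUnit γ.det)
    (x y : Polynomial F) (hxy : IsCoprime x y)
    (hcop : IsCoprime 𝔫 (γ 1 0 * x + γ 1 1 * y)) :
    ∃ γ₀ : Matrix (Fin 2) (Fin 2) (Polynomial F), InGamma0 F 𝔫 γ₀ ∧
      ∃ c d : Polynomial F, γ₀ * γ = !![y, -x; c, d] ∧ y * d + x * c = γ.det := by
  obtain ⟨v, hv⟩ := hγ.exists_right_inv
  obtain ⟨s, t, hst⟩ := hxy
  have hdet := Matrix.det_fin_two γ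
  have hv' := hv
  rw [hdet] at hv'
  set p := v * (γ 1 0 * x + γ 1 1 * y) with hp
  set q := -v * (γ 0 1 * y + γ 0 0 * x) with hq
  have h1 : p * γ 0 0 + q * γ 1 0 = y := by
    rw [hp, hq]; linear_combination y * hv'
  have h2 : p * γ 0 1 + q * γ 1 1 = -x := by
    rw [hp, hq]; linear_combination -x * hv'
  have hpq : IsCoprime p q :=
    ⟨t * γ 0 0 - s * γ 0 1, t * γ 1 0 - s * γ 1 1, by linear_combination hst + t * h1 - s * h2⟩
  have hvu : IsUnit v := IsUnit.of_mul_eq_one γ.det (by rw [mul_comm]; exact hv)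
  have hpn : IsCoprime p 𝔫 := (isCoprime_mul_unit_left_left hvu _ _).2 hcop.symm
  obtain ⟨s', r', hsr⟩ := hpn.mul_right hpq
  have hdet0 : (!![p, q; -(𝔫 * r'), s']).det = 1 := by
    rw [Matrix.det_fin_two_of]; linear_combination hsr
  refine ⟨!![p, q; -(𝔫 * r'), s'], ⟨by rw [hdet0]; exact isUnit_one, ?_⟩, ?_⟩
  · simp
  refine ⟨-(𝔫 * r') * γ 0 0 + s' * γ 1 0, -(𝔫 * r') * γ 0 1 + s' * γ 1 1, ?_, ?_⟩
  · conv_lhs => rw [Matrix.eta_fin_two γ, Matrix.mul_fin_two]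
    rw [h1, h2]
  · rw [hdet, ← h1]
    have h2' : x = -(p * γ 0 1 + q * γ 1 1) := by rw [h2, neg_neg]
    rw [h2']
    linear_combination (γ 0 0 * γ 1 1 - γ 0 1 * γ 1 0) * hsr

/-- **Standard form of the edge `γ·e₀` (part 2)**, via the Atkin–Lehner matrix `w_𝔫`. -/
theorem standard_form_edge_part2
    (Fq : Type) [Field Fq] [Fintype Fq]
    (𝔫 : Polynomial Fq) (h𝔫 : 𝔫.Monic)
    (γ : Matrix (Fin 2) (Fin 2) (Polynomial Fq)) (hγ : IsUnit γ.det)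
    (x y : Polynomial Fq) (hxy : IsCoprime x y)
    (hcop : IsCoprime 𝔫 (γ 1 0 * x + γ 1 1 * y))
    (δ : ℕ) (hδ : (δ : WithBot ℕ) = max x.degree y.degree)
    (ε : ℕ) (hε : ε = if y.degree < x.degree then 0 else 1) :
    ∃ γ₀ : Matrix (Fin 2) (Fin 2) (Polynomial Fq), InGamma0 Fq 𝔫 γ₀ ∧
      ∃ (u z : Kinf Fq) (κ : Matrix (Fin 2) (Fin 2) (Kinf Fq)), z ≠ 0 ∧ InIw Fq κ ∧
        (γ₀ * γ).map (polyToK Fq) =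
          wmat Fq 𝔫 * !![piInf Fq ^ (𝔫.natDegree + 2 * δ + ε), u; 0, 1] *
            Jmat Fq ^ ε * (z • (1 : Matrix (Fin 2) (Fin 2) (Kinf Fq))) * κ := by
  obtain ⟨γ₀, hγ₀, c, d, hmul, hrel⟩ := exists_gamma0_top_row Fq 𝔫 γ hγ x y hxy hcop
  refine ⟨γ₀, hγ₀, ?_⟩
  rw [hmul]
  have hrelK := congrArg (polyToK Fq) hrel
  simp only [map_add, map_mul] at hrelK
  have hn0 := polyToK_ne_zero Fq h𝔫.ne_zero
  have hD0 := polyToK_ne_zero Fq hγ.ne_zero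
  have hDord : (polyToK Fq γ.det).order = 0 := by
    rw [polyToK_order Fq hγ.ne_zero, Polynomial.natDegree_eq_zero_of_isUnit hγ]; rfl
  have hnord := polyToK_order Fq h𝔫.ne_zero
  have hπ0 := piInf_ne_zero Fq
  have hmap : (!![y, -x; c, d]).map (polyToK Fq) =
      !![polyToK Fq y, -polyToK Fq x; polyToK Fq c, polyToK Fq d] := by
    ext i j; fin_cases i <;> fin_cases j <;> simp
  rw [hmap]
  generalize polyToK Fq γ.det = D at *
  by_cases hlt : y.degree < x.degree
  · rw [if_pos hlt] at hε
    subst hε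
    have hx : x ≠ 0 := Polynomial.ne_zero_of_degree_gt hlt
    rw [max_eq_left hlt.le, Polynomial.degree_eq_natDegree hx, Nat.cast_inj] at hδ
    have hX0 := polyToK_ne_zero Fq hx
    have hXord := polyToK_order Fq hx
    have hyx : ∀ n : ℤ, n < 1 → (-(polyToK Fq y / polyToK Fq x)).coeff n = 0 := by
      intro n hn
      rw [HahnSeries.coeff_neg, neg_eq_zero]
      rcases eq_or_ne y 0 with rfl | hy
      · simp
      have := Polynomial.natDegree_lt_natDegree hy hlt
      exact polyToK_div_coeff_of_lt Fq hx (by omega)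
    set k := 𝔫.natDegree + 2 * δ + 0 with hk
    have hπk : piInf Fq ^ k ≠ 0 := pow_ne_zero _ hπ0
    have hden : polyToK Fq 𝔫 * polyToK Fq x ^ 2 * piInf Fq ^ k ≠ 0 :=
      mul_ne_zero (mul_ne_zero hn0 (pow_ne_zero _ hX0)) hπk
    set e : Kinf Fq := D / (polyToK Fq 𝔫 * polyToK Fq x ^ 2 * piInf Fq ^ k) with he
    have he0 : e ≠ 0 := div_ne_zero hD0 hden
    have heord : e.order = 0 := by
      rw [he, order_div hD0 hden, HahnSeries.order_mul (mul_ne_zero hn0 (pow_ne_zero _ hX0)) hπk,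
        HahnSeries.order_mul hn0 (pow_ne_zero _ hX0), HahnSeries.order_pow, piInf_pow_order,
        hDord, hnord, hXord, hk, hδ]
      simp only [nsmul_eq_mul]
      push_cast
      ring
    refine ⟨polyToK Fq d / (polyToK Fq 𝔫 * polyToK Fq x), polyToK Fq x,
      !![e, 0; -(polyToK Fq y / polyToK Fq x), 1], hX0, ⟨⟨?_, ?_⟩, ?_⟩, ?_⟩
    · intro i j
      fin_cases i <;> fin_cases j
      · exact memO_of_order_eq_zero Fq heord
      · exact memO_zero Fq
      · exact fun n hn => hyx n (by omega)
      · exact memO_one Fq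
    · rw [Matrix.det_fin_two_of]
      simpa using coeff_zero_ne_zero Fq he0 heord
    · exact hyx
    · rw [wmat, pow_zero, mul_one, Matrix.one_fin_two, Matrix.smul_of]
      simp only [Matrix.smul_cons, Matrix.smul_empty, smul_eq_mul, mul_one, mul_zero,
        Matrix.mul_fin_two, he]
      refine fin_two_congr ?_ ?_ ?_ ?_
      · field_simp
        ring
      · ring
      · rw [← hrelK]
        field_simp
        ring
      · field_simp
        ring
  · rw [if_neg hlt] at hε
    subst hε
    push Not at hlt
    have hy : y ≠ 0 := by
      rintro rfl
      have hx : x = 0 := by simpa using hlt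
      simp [hx] at hδ
    rw [max_eq_right hlt, Polynomial.degree_eq_natDegree hy, Nat.cast_inj] at hδ
    have hY0 := polyToK_ne_zero Fq hy
    have hYord := polyToK_order Fq hy
    have hxy' : memO Fq (-(polyToK Fq x / polyToK Fq y)) := by
      have := Polynomial.natDegree_le_natDegree hlt
      exact memO_neg Fq fun n hn => polyToK_div_coeff_of_lt Fq hy (by omega)
    set m := 𝔫.natDegree + 2 * δ with hm
    have hπk : piInf Fq ^ m ≠ 0 := pow_ne_zero _ hπ0
    have hden : polyToK Fq 𝔫 * polyToK Fq y ^ 2 * piInf Fq ^ m ≠ 0 :=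
      mul_ne_zero (mul_ne_zero hn0 (pow_ne_zero _ hY0)) hπk
    set e : Kinf Fq := D / (polyToK Fq 𝔫 * polyToK Fq y ^ 2 * piInf Fq ^ m) with he
    have he0 : e ≠ 0 := div_ne_zero hD0 hden
    have heord : e.order = 0 := by
      rw [he, order_div hD0 hden, HahnSeries.order_mul (mul_ne_zero hn0 (pow_ne_zero _ hY0)) hπk,
        HahnSeries.order_mul hn0 (pow_ne_zero _ hY0), HahnSeries.order_pow, piInf_pow_order,
        hDord, hnord, hYord, hm, hδ]
      simp only [nsmul_eq_mul]
      push_cast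
      ring
    refine ⟨-(polyToK Fq c / (polyToK Fq 𝔫 * polyToK Fq y)), -(polyToK Fq y / piInf Fq),
      !![1, -(polyToK Fq x / polyToK Fq y); 0, -e], neg_ne_zero.2 (div_ne_zero hY0 hπ0),
      ⟨⟨?_, ?_⟩, ?_⟩, ?_⟩
    · intro i j
      fin_cases i <;> fin_cases j
      · exact memO_one Fq
      · exact hxy'
      · exact memO_zero Fq
      · exact memO_neg Fq (memO_of_order_eq_zero Fq heord)
    · rw [Matrix.det_fin_two_of]
      simpa using coeff_zero_ne_zero Fq he0 heord
    · exact fun _ _ => rfl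
    · rw [wmat, Jmat, pow_one, pow_succ, Matrix.one_fin_two, Matrix.smul_of]
      simp only [Matrix.smul_cons, Matrix.smul_empty, smul_eq_mul, mul_one, mul_zero,
        Matrix.mul_fin_two, he]
      refine fin_two_congr ?_ ?_ ?_ ?_
      · field_simp
        ring
      · field_simp
        ring
      · field_simp
        ring
      · rw [← hrelK]
        field_simp
        ring
end SturmFF
end
end
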